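/- Let L, L' ⊆ k̄² be two non-parallel lines, each defined over 𝔽_q (zero sets of equations ax + by = c with a, b, c ∈ 𝔽_q, (a,b) ≠ (0,0), meeting in exactly one point). Let a(n) be the number of n-element subsets S ⊆ k̄² \ (L ∪ L') with σ(S) = S. Then for n even, n > 0: a(n) = ((q⁴ − 1)/(q² + q + 1)²) · ( q^{2n} − q^{n/2} · ( (n/2) · (q³ − 1)(q − 1)/(q⁴ − 1) + 1 ) ); and for n odd, n > 1: a(n) = ((q⁴ − 1)/(q² + q + 1)²) · ( q^{2n} + q^{(n−1)/2} · ( ((n−1)/2) · (q³ − 1)/(q² + 1) − (q − 1)(2q² + q + 1)/(q⁴ − 1) ) ). -/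

import Mathlib

/-- The `q`-power Frobenius acting coordinatewise on `k̄^N`,
where `q = |k|`. -/
noncomputable def afFrob (k : Type*) [Field k] [Fintype k] (N : ℕ) :
    (Fin N → AlgebraicClosure k) → (Fin N → AlgebraicClosure k) :=
  fun v i => (v i) ^ (Fintype.card k)

/-- The number of `n`-element subsets `S` of `A ⊆ X` with `σ(S) = S`. -/
noncomputable def nSetCount {X : Type*} (σ : X → X) (A : Set X) (n : ℕ) : ℕ :=
  Set.ncard {S : Set X | S ⊆ A ∧ S.Finite ∧ S.ncard = n ∧ σ '' S = S}

noncomputable def eSer (d : ℕ) : PowerSeries ℚ :=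
  PowerSeries.mk fun m => if m = 0 then 0 else if d ∣ m then (-1) ^ (m / d + 1) else 0

lemma eSer_eq (d : ℕ) (hd : 0 < d) :
    (1 + PowerSeries.X ^ d) * eSer d = (PowerSeries.X ^ d : PowerSeries ℚ) := by
  ext n
  rw [add_mul, one_mul, map_add, PowerSeries.coeff_X_pow_mul', PowerSeries.coeff_X_pow]
  simp only [eSer, PowerSeries.coeff_mk]
  by_cases h : d ≤ n
  · obtain ⟨m, rfl⟩ := Nat.exists_eq_add_of_le h
    have h1 : d + m ≠ 0 := by omega
    simp only [h, if_true, Nat.add_sub_cancel_left, h1, if_false]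
    by_cases hm : m = 0
    · subst hm; simp [Nat.div_self hd]
    · have h2 : d + m ≠ d := by omega
      simp only [hm, if_false, h2]
      by_cases hdm : d ∣ m
      · have h3 : d ∣ d + m := by simpa using hdm
        simp only [hdm, h3, if_true]
        rw [Nat.add_div_left _ hd]
        simp [pow_succ]
      · have h3 : ¬ d ∣ d + m := by simpa using hdm
        simp [hdm, h3]
  · have h2 : n ≠ d := by omega
    simp only [h, h2, if_false]
    by_cases hn : n = 0
    · simp [hn]
    · have : ¬ d ∣ n := fun hh => h (Nat.le_of_dvd (by omega) hh)
      simp [hn, this]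

open Classical in
lemma orbit_card {Y : Type*} [Fintype Y] (σ : Equiv.Perm Y) (x : Y) :
    (Finset.univ.filter (fun y => σ.SameCycle x y)).card = Function.minimalPeriod σ x := by
  have hpos : 0 < Function.minimalPeriod σ x :=
    Function.minimalPeriod_pos_of_mem_periodicPts (by
      refine ⟨orderOf σ, orderOf_pos σ, ?_⟩
      rw [Function.IsPeriodicPt, Function.IsFixedPt, ← Equiv.Perm.coe_pow, pow_orderOf_eq_one]
      rfl)
  have : Finset.univ.filter (fun y => σ.SameCycle x y) =
      (Finset.range (Function.minimalPeriod σ x)).image (fun i => σ^[i] x) := by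
    ext y
    simp only [Finset.mem_filter, Finset.mem_univ, true_and, Finset.mem_image, Finset.mem_range]
    constructor
    · intro h
      obtain ⟨i, -, hi⟩ := h.exists_pow_eq'
      refine ⟨i % Function.minimalPeriod σ x, Nat.mod_lt _ hpos, ?_⟩
      rw [Function.iterate_mod_minimalPeriod_eq, ← Equiv.Perm.coe_pow, hi]
    · rintro ⟨i, -, rfl⟩
      rw [← Equiv.Perm.coe_pow]
      exact ⟨i, by simp⟩
  rw [this, Finset.card_image_of_injOn, Finset.card_range]
  intro i hi j hj h
  exact Function.iterate_injOn_Iio_minimalPeriod (by simpa using hi) (by simpa using hj) h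

open Classical in
noncomputable def stabSets {Y : Type*} [Fintype Y] (σ : Equiv.Perm Y) (n : ℕ) : Finset (Finset Y) :=
  Finset.univ.filter fun S => S.card = n ∧ ∀ y, σ y ∈ S ↔ y ∈ S

open Classical in
lemma mem_of_sameCycle {Y : Type*} [Fintype Y] (σ : Equiv.Perm Y) (S : Finset Y)
    (hS : ∀ y, σ y ∈ S ↔ y ∈ S) {x y : Y} (h : σ.SameCycle x y) : y ∈ S ↔ x ∈ S := by
  obtain ⟨i, -, rfl⟩ := h.exists_pow_eq'
  induction i with
  | zero => simp
  | succ i ih => rw [pow_succ', Equiv.Perm.mul_apply, hS, ih ⟨i, by simp⟩]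

open Classical in
lemma stab_shift {Y : Type*} [Fintype Y] (σ : Equiv.Perm Y) (x : Y) (n : ℕ) :
    ((stabSets σ n).filter (fun S => x ∉ S)).card =
    ((stabSets σ (n + Function.minimalPeriod σ x)).filter (fun S => x ∈ S)).card := by
  rw [← orbit_card]
  set O := Finset.univ.filter (fun y => σ.SameCycle x y) with hO
  have hxO : x ∈ O := by simp [hO, Equiv.Perm.SameCycle.refl]
  have hOs : ∀ y, σ y ∈ O ↔ y ∈ O := by intro y; simp [hO]
  refine Finset.card_bij' (fun S _ => S ∪ O) (fun S _ => S \ O) ?_ ?_ ?_ ?_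
  · intro S hS
    simp only [stabSets, Finset.mem_filter, Finset.mem_univ, true_and] at hS ⊢
    obtain ⟨⟨h1, h2⟩, h3⟩ := hS
    refine ⟨⟨?_, fun y => by simp only [Finset.mem_union, h2, hOs]⟩, by simp [hxO]⟩
    rw [Finset.card_union_of_disjoint, h1]
    rw [Finset.disjoint_right]
    intro y hy
    rw [mem_of_sameCycle σ S h2 (by simpa [hO] using hy)]
    exact h3
  · intro S hS
    simp only [stabSets, Finset.mem_filter, Finset.mem_univ, true_and] at hS ⊢
    obtain ⟨⟨h1, h2⟩, h3⟩ := hS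
    refine ⟨⟨?_, fun y => by simp only [Finset.mem_sdiff, h2, hOs]⟩, by simp [hxO]⟩
    rw [Finset.card_sdiff_of_subset, h1]
    · omega
    intro y hy
    rw [mem_of_sameCycle σ S h2 (by simpa [hO] using hy)]
    exact h3
  · intro S hS
    simp only [stabSets, Finset.mem_filter, Finset.mem_univ, true_and] at hS
    obtain ⟨⟨h1, h2⟩, h3⟩ := hS
    have : Disjoint S O := by
      rw [Finset.disjoint_right]
      intro y hy
      rw [mem_of_sameCycle σ S h2 (by simpa [hO] using hy)]
      exact h3
    exact Finset.union_sdiff_cancel_right this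
  · intro S hS
    simp only [stabSets, Finset.mem_filter, Finset.mem_univ, true_and] at hS
    obtain ⟨⟨h1, h2⟩, h3⟩ := hS
    apply Finset.sdiff_union_of_subset
    intro y hy
    rw [mem_of_sameCycle σ S h2 (by simpa [hO] using hy)]
    exact h3

lemma minPer_pos {Y : Type*} [Fintype Y] (σ : Equiv.Perm Y) (x : Y) :
    0 < Function.minimalPeriod σ x := by
  classical
  rw [← orbit_card]
  exact Finset.card_pos.2 ⟨x, by simp [Equiv.Perm.SameCycle.refl]⟩

noncomputable def aSer {Y : Type*} [Fintype Y] (σ : Equiv.Perm Y) : PowerSeries ℚ :=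
  PowerSeries.mk fun n => ((stabSets σ n).card : ℚ)

open Classical in
noncomputable def uSer {Y : Type*} [Fintype Y] (σ : Equiv.Perm Y) (x : Y) : PowerSeries ℚ :=
  PowerSeries.mk fun n => (((stabSets σ n).filter (fun S => x ∈ S)).card : ℚ)

lemma uSer_eq {Y : Type*} [Fintype Y] (σ : Equiv.Perm Y) (x : Y) :
    uSer σ x = eSer (Function.minimalPeriod σ x) * aSer σ := by
  classical
  set d := Function.minimalPeriod σ x with hd
  have hpos : 0 < d := minPer_pos σ x
  have key : uSer σ x = PowerSeries.X ^ d * (aSer σ - uSer σ x) := by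
    ext n
    rw [PowerSeries.coeff_X_pow_mul']
    by_cases h : d ≤ n
    · obtain ⟨m, rfl⟩ := Nat.exists_eq_add_of_le h
      rw [if_pos h, Nat.add_sub_cancel_left, map_sub]
      simp only [uSer, aSer, PowerSeries.coeff_mk]
      rw [add_comm d m, hd, ← stab_shift]
      rw [← Finset.card_filter_add_card_filter_not (s := stabSets σ m) (fun S => x ∈ S)]
      push_cast; ring
    · rw [if_neg h]
      simp only [uSer, PowerSeries.coeff_mk, Nat.cast_eq_zero, Finset.card_eq_zero]
      rw [Finset.filter_eq_empty_iff]
      intro S hS hx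
      simp only [stabSets, Finset.mem_filter, Finset.mem_univ, true_and] at hS
      apply h
      rw [hd, ← orbit_card, ← hS.1]
      apply Finset.card_le_card
      intro y hy
      rw [mem_of_sameCycle σ S hS.2 (by simpa using hy)]
      exact hx
  have h1 := eSer_eq d hpos
  have hne : (1 + PowerSeries.X ^ d : PowerSeries ℚ) ≠ 0 := by
    intro h
    have := congrArg (PowerSeries.coeff 0) h
    rw [map_add, PowerSeries.coeff_X_pow] at this
    simp [hpos.ne] at this
  apply mul_left_cancel₀ hne
  linear_combination key - aSer σ * h1

lemma sum_uSer {Y : Type*} [Fintype Y] (σ : Equiv.Perm Y) (n : ℕ) :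
    PowerSeries.coeff n (∑ x, uSer σ x) = n * (stabSets σ n).card := by
  classical
  rw [map_sum]
  simp only [uSer, PowerSeries.coeff_mk]
  simp only [Finset.card_filter]
  push_cast
  rw [Finset.sum_comm, mul_comm, ← nsmul_eq_mul, ← Finset.sum_const]
  apply Finset.sum_congr rfl
  intro S hS
  simp only [stabSets, Finset.mem_filter, Finset.mem_univ, true_and] at hS
  rw [← hS.1]
  simp

lemma rec_perm {Y : Type*} [Fintype Y] (σ : Equiv.Perm Y) (n : ℕ) :
    (n : ℚ) * (stabSets σ n).card = ∑ p ∈ Finset.HasAntidiagonal.antidiagonal n,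
      (∑ x, PowerSeries.coeff p.1 (eSer (Function.minimalPeriod σ x))) * (stabSets σ p.2).card := by
  rw [← sum_uSer]
  simp only [uSer_eq]
  rw [← Finset.sum_mul, PowerSeries.coeff_mul]
  simp [aSer]

open Classical in
lemma coeff_eSum {Y : Type*} [Fintype Y] (σ : Equiv.Perm Y) (m : ℕ) (hm : 0 < m) :
    (∑ x, PowerSeries.coeff m (eSer (Function.minimalPeriod σ x))) =
      ((Finset.univ.filter fun y => σ^[m] y = y).card : ℚ) -
       2 * (if Even m then ((Finset.univ.filter fun y => σ^[m/2] y = y).card : ℚ) else 0) := by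
  have : ∀ x, PowerSeries.coeff m (eSer (Function.minimalPeriod σ x)) =
     (if σ^[m] x = x then 1 else 0) -
       2 * (if Even m then (if σ^[m/2] x = x then 1 else 0) else 0) := by
    intro x
    have hp := minPer_pos σ x
    have h1 : ∀ i, σ^[i] x = x ↔ Function.minimalPeriod σ x ∣ i := fun i =>
      Function.isPeriodicPt_iff_minimalPeriod_dvd
    simp only [h1]
    generalize Function.minimalPeriod σ x = d at *
    simp only [eSer, PowerSeries.coeff_mk, hm.ne', if_false]
    by_cases hd : d ∣ m
    · obtain ⟨j, rfl⟩ := hd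
      simp only [dvd_mul_right, if_true, Nat.mul_div_cancel_left _ hp]
      rcases Nat.even_or_odd j with ⟨l, rfl⟩ | hj
      · have e1 : d * (l + l) = 2 * (d * l) := by ring
        rw [e1]
        simp [pow_succ]; norm_num
      · have : ¬ (Even (d * j) ∧ d ∣ d * j / 2) := by
          rintro ⟨h2, l, hl⟩
          have h3 : d * j = 2 * (d * l) := by rw [← hl]; exact (Nat.two_mul_div_two_of_even h2).symm
          have : j = 2 * l := by
            apply Nat.eq_of_mul_eq_mul_left hp; rw [h3]; ring
          rw [this] at hj
          exact (Nat.not_odd_iff_even.2 (by simp)) hj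
        rw [← ite_and, if_neg this, Odd.add_one hj |>.neg_one_pow]
        simp
    · have : ¬ (Even m ∧ d ∣ m / 2) := by
        rintro ⟨h2, hl⟩
        apply hd
        rw [← Nat.two_mul_div_two_of_even h2]
        exact Dvd.dvd.mul_left hl 2
      rw [← ite_and, if_neg this]
      simp [hd]
  simp only [this]
  rw [Finset.sum_sub_distrib, ← Finset.mul_sum]
  congr 1
  · simp
  · split_ifs <;> simp

section SeriesPart
open PowerSeries

lemma geo1 (r : ℚ) : (1 - C r * X) * PowerSeries.mk (fun n => r ^ n) = 1 := by
  ext n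
  rw [sub_mul, one_mul, map_sub, mul_assoc, coeff_C_mul]
  cases n with
  | zero => simp
  | succ n => rw [coeff_succ_X_mul, coeff_mk, coeff_mk, coeff_one]; simp; ring

lemma geo2 (r : ℚ) : (1 - C r * X ^ 2) * PowerSeries.mk (fun n => if Even n then r ^ (n / 2) else 0) = 1 := by
  ext n
  rw [sub_mul, one_mul, map_sub, mul_assoc, coeff_C_mul, coeff_X_pow_mul', coeff_one]
  rcases n with _ | _ | n
  · simp
  · simp
  · simp only [coeff_mk, add_tsub_cancel_right, Nat.even_add, even_two, iff_true]
    rw [show (n + 1 + 1) / 2 = n / 2 + 1 by omega]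
    simp [Nat.even_add_one]; split_ifs <;> simp [pow_succ] <;> ring

lemma geo3 (r : ℚ) : (1 - C r * X ^ 2) * PowerSeries.mk (fun n => if Even n then ((n / 2 : ℕ) : ℚ) * r ^ (n / 2) else 0)
   = C r * X ^ 2 * PowerSeries.mk (fun n => if Even n then r ^ (n / 2) else 0) := by
  ext n
  rw [sub_mul, one_mul, map_sub, mul_assoc, coeff_C_mul, coeff_X_pow_mul', mul_assoc, coeff_C_mul, coeff_X_pow_mul']
  rcases n with _ | _ | n
  · simp
  · simp
  · simp only [coeff_mk, add_tsub_cancel_right]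
    rw [show (n + 1 + 1) / 2 = n / 2 + 1 by omega]
    simp [Nat.even_add_one]; split_ifs <;> simp [pow_succ] <;> ring

/-- the series of the claimed values -/
noncomputable def gSer (q w : ℚ) : PowerSeries ℚ :=
  1 + C ((q^4-1)*w^2) * PowerSeries.mk (fun n => (q^2) ^ n)
   + (C ((q-1)^2*(q+1)*w) * X - C ((q-1)^2*w)) *
      PowerSeries.mk (fun n => if Even n then ((n / 2 : ℕ) : ℚ) * q ^ (n / 2) else 0)
   - (C ((q-1)*(2*q^2+q+1)*w^2) * X + C ((q^4-1)*w^2)) *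
      PowerSeries.mk (fun n => if Even n then q ^ (n / 2) else 0)

noncomputable def cSer (q : ℚ) : PowerSeries ℚ :=
  PowerSeries.mk (fun m => if m = 0 then 0 else (q^m-1)^2 - 2 * (if Even m then (q^(m/2)-1)^2 else 0))

lemma gSer_rat (q w : ℚ) (hw : w * (q^2+q+1) = 1) :
    (1 - C q ^2 * X) * (1 - C q * X^2)^2 * gSer q w =
      (1 - C q * X)^2*(1+X)*(1-C q^2 * X^2) := by
  have h1 := geo1 (q^2)
  have h2 := geo2 q
  have h3 := geo3 q
  have hW : (C w * (C q ^2 + C q + 1) : PowerSeries ℚ) = 1 := by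
    rw [← map_pow, ← map_add, ← map_one (C (R := ℚ)), ← map_add, ← map_mul, hw]
  unfold gSer
  generalize PowerSeries.mk (fun n => (q^2) ^ n) = S at *
  generalize PowerSeries.mk (fun n => if Even n then q ^ (n / 2) else 0) = E1 at *
  generalize PowerSeries.mk (fun n => if Even n then ((n / 2 : ℕ) : ℚ) * q ^ (n / 2) else 0) = E2 at *
  have c2 : (C (2:ℚ) : PowerSeries ℚ) = 2 := map_ofNat _ 2
  simp only [map_mul, map_sub, map_add, map_pow, map_one, c2] at *
  generalize (C w : PowerSeries ℚ) = W at *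
  generalize (C q : PowerSeries ℚ) = R at *
  generalize (X : PowerSeries ℚ) = t at *
  -- reduce
  have e1 : (1 - R^2*t)*(1-R*t^2)^2 * S = (1-R*t^2)^2 := by linear_combination (1-R*t^2)^2 * h1
  have e2 : (1 - R^2*t)*(1-R*t^2)^2 * E1 = (1-R^2*t)*(1-R*t^2) := by
    linear_combination (1-R^2*t)*(1-R*t^2) * h2
  have e3 : (1 - R^2*t)*(1-R*t^2)^2 * E2 = (1-R^2*t)*(R*t^2) := by
    linear_combination (1-R^2*t)*(1-R*t^2) * h3 + (1-R^2*t)*(R*t^2)*h2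
  have hs : (R^2+R+1)^2 ≠ 0 := by
    apply pow_ne_zero
    intro h
    rw [h, mul_zero] at hW
    exact zero_ne_one hW
  apply mul_left_cancel₀ hs
  linear_combination (R^2+R+1)^2 * ((R^4-1)*W^2 * e1 + ((R-1)^2*(R+1)*W*t - (R-1)^2*W) * e3
      - ((R-1)*(2*R^2+R+1)*W^2*t + (R^4-1)*W^2) * e2)
    + (W*(R^2+R+1)+1) * ((R^4-1)*(1-R*t^2)^2 - (R^4-1)*(1-R^2*t)*(1-R*t^2)
        - (R-1)*(2*R^2+R+1)*t*(1-R^2*t)*(1-R*t^2)) * hW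
    + (R^2+R+1) * (((R-1)^2*(R+1)*t-(R-1)^2)*(1-R^2*t)*(R*t^2)) * hW

lemma cSer_eq (q : ℚ) : ∃ S Sb Sc Sd Se E1 : PowerSeries ℚ, (1 - C q ^2 * X) * S = 1 ∧
   (1 - C q * X) * Sb = 1 ∧ (1 - X) * Sc = 1 ∧ (1 - C q ^2 * X^2) * Sd = 1 ∧ (1 - X^2) * Se = 1 ∧
   (1 - C q * X^2) * E1 = 1 ∧ cSer q = (S - 2 * Sb + Sc) - 2 * (Sd - 2 * E1 + Se) := by
  have h1 := geo1 (q^2)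
  have h3 := geo1 1
  have h4 := geo2 (q^2)
  have h5 := geo2 1
  rw [map_pow] at h1 h4
  rw [map_one, one_mul] at h3 h5
  refine ⟨_, _, _, _, _, _, h1, geo1 q, h3, h4, h5, geo2 q, ?_⟩
  have c2 : (2 : PowerSeries ℚ) = C (2:ℚ) := (map_ofNat _ 2).symm
  rw [c2]
  ext m
  simp only [map_sub, map_add, coeff_C_mul, cSer, coeff_mk]
  split_ifs
  · subst_vars; simp; norm_num
  · subst_vars; simp at *
  · rw [one_pow, one_pow]; ring
  · rw [one_pow]; ring

lemma gSer_deriv (q w : ℚ) (hw : w * (q^2+q+1) = 1) :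
    X * d⁄dX ℚ (gSer q w) = cSer q * gSer q w := by
  have h := gSer_rat q w hw
  have h' := congrArg (d⁄dX ℚ) h
  obtain ⟨S, Sb, Sc, Sd, Se, E1, h1, h2, h3, h4, h5, h6, hc⟩ := cSer_eq q
  have dC : d⁄dX ℚ (C q) = 0 := derivative_C
  simp only [Derivation.leibniz, map_sub, map_add, Derivation.leibniz_pow, Derivation.map_one_eq_zero, dC, derivative_X, smul_eq_mul, nsmul_eq_mul] at h'
  have hne : ((1 - X) * ((1 - C q ^2 * X) * (1 - C q * X^2)^2) * ((1 - C q * X)^2*(1+X)*(1-C q^2 * X^2)) : PowerSeries ℚ) ≠ 0 := by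
    intro h
    have := congrArg constantCoeff h
    simp at this
  apply mul_left_cancel₀ hne
  rw [hc]
  generalize d⁄dX ℚ (gSer q w) = G' at *
  generalize gSer q w = G at *
  generalize (C q : PowerSeries ℚ) = R at *
  generalize (X : PowerSeries ℚ) = t at *
  push_cast at h'
  norm_num at h'
  linear_combination (1-t)*((1 - R * t) ^ 2 * (1 + t) * (1 - R ^ 2 * t ^ 2))*t*h'
    - (1-t)*t*(-((1 - R * t) ^ 2 * (1 + t) * (R ^ 2 * (2 * t))) +
      (1 - R ^ 2 * t ^ 2) * ((1 - R * t) ^ 2 + -((1 + t) * (2 * ((1 - R * t) * R)))))*h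
    - G * ((1-t)*(1-R*t^2)^2*(1-R*t)^2*(1+t)*(1-R^2*t^2) * h1
      - 2 * ((1-t)*(1-R^2*t)*(1-R*t^2)^2*(1-R*t)*(1+t)*(1-R^2*t^2)) * h2
      + (1-R^2*t)*(1-R*t^2)^2*(1-R*t)^2*(1+t)*(1-R^2*t^2) * h3
      - 2 * ((1-t)*(1-R^2*t)*(1-R*t^2)^2*(1-R*t)^2*(1+t) * h4
        - 2 * ((1-t)*(1-R^2*t)*(1-R*t^2)*(1-R*t)^2*(1+t)*(1-R^2*t^2)) * h6
        + (1-R^2*t)*(1-R*t^2)^2*(1-R*t)^2*(1-R^2*t^2) * h5))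

end SeriesPart

lemma exists_period {Z : Type*} (σ : Z → Z) (hσ : Function.Injective σ) (S : Set Z)
    (hf : S.Finite) (hS : σ '' S = S) (x : Z) (hx : x ∈ S) :
    ∃ m, 0 < m ∧ m ≤ S.ncard ∧ σ^[m] x = x := by
  classical
  have hit : ∀ i, σ^[i] x ∈ S := by
    intro i
    induction i with
    | zero => exact hx
    | succ i ih =>
      rw [Function.iterate_succ_apply', ← hS]
      exact ⟨_, ih, rfl⟩
  have hc : hf.toFinset.card < (Finset.range (S.ncard + 1)).card := by
    rw [← Set.ncard_eq_toFinset_card S hf]; simp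
  obtain ⟨i, hi, j, hj, hne, hij⟩ := Finset.exists_ne_map_eq_of_card_lt_of_maps_to hc
    (f := fun i => σ^[i] x) (fun i _ => by simpa using hit i)
  simp only [Finset.mem_range] at hi hj
  have aux : ∀ i j, i < j → j < S.ncard + 1 → σ^[i] x = σ^[j] x →
      ∃ m, 0 < m ∧ m ≤ S.ncard ∧ σ^[m] x = x := by
    intro i j h1 h2 h3
    refine ⟨j - i, by omega, by omega, ?_⟩
    apply hσ.iterate i
    rw [← Function.iterate_add_apply, show i + (j - i) = j by omega, h3]
  rcases lt_or_gt_of_ne hne with h | h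
  · exact aux i j h hj hij
  · exact aux j i h hi hij.symm

lemma main_abs {Z : Type*} (σ : Z → Z) (hσ : Function.Injective σ) (A : Set Z)
    (hA : ∀ x ∈ A, σ x ∈ A) (q w : ℚ) (hw : w * (q^2+q+1) = 1)
    (hN : ∀ m, 0 < m → {x | x ∈ A ∧ σ^[m] x = x}.Finite ∧
      (({x | x ∈ A ∧ σ^[m] x = x}.ncard : ℕ) : ℚ) = (q^m-1)^2) (n : ℕ) :
    (nSetCount σ A n : ℚ) = PowerSeries.coeff n (gSer q w) := by
  classical
  induction n using Nat.strong_induction_on with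
  | _ n ih =>
  rcases Nat.eq_zero_or_pos n with rfl | hn
  · have : {S : Set Z | S ⊆ A ∧ S.Finite ∧ S.ncard = 0 ∧ σ '' S = S} = {∅} := by
      ext S
      simp only [Set.mem_setOf_eq, Set.mem_singleton_iff]
      constructor
      · rintro ⟨-, h1, h2, -⟩
        exact (Set.ncard_eq_zero h1).1 h2
      · rintro rfl
        simp
    rw [nSetCount, this]
    simp [gSer]
  set T : Set Z := {x | x ∈ A ∧ ∃ m, 0 < m ∧ m ≤ n ∧ σ^[m] x = x} with hT
  have hTf : T.Finite := by
    apply Set.Finite.subset (Set.Finite.biUnion (Set.finite_Icc 1 n)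
      (t := fun m => {x | x ∈ A ∧ σ^[m] x = x}) (fun m hm => (hN m hm.1).1))
    rintro x ⟨hx, m, h1, h2, h3⟩
    simp only [Set.mem_iUnion]
    exact ⟨m, ⟨h1, h2⟩, hx, h3⟩
  have hTσ : ∀ x ∈ T, σ x ∈ T := by
    rintro x ⟨hx, m, h1, h2, h3⟩
    refine ⟨hA x hx, m, h1, h2, ?_⟩
    rw [← Function.iterate_succ_apply, Function.iterate_succ_apply', h3]
  haveI : Fintype T := hTf.fintype
  let f : T → T := fun x => ⟨σ x, hTσ x x.2⟩
  have hf : Function.Injective f := by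
    intro x y h
    exact Subtype.ext (hσ (congrArg Subtype.val h))
  let τ : Equiv.Perm T := Equiv.ofBijective f (Finite.injective_iff_bijective.1 hf)
  have hτ : ∀ x : T, ((τ x : T) : Z) = σ x := fun x => rfl
  have hτi : ∀ m (x : T), ((τ^[m] x : T) : Z) = σ^[m] x := by
    intro m x
    induction m with
    | zero => rfl
    | succ m ihm => rw [Function.iterate_succ_apply', Function.iterate_succ_apply', hτ, ihm]
  have hcount : ∀ j, j ≤ n → nSetCount σ A j = (stabSets τ j).card := by
    intro j hj
    rw [nSetCount, ← Set.ncard_coe_finset,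
      ← Set.ncard_image_of_injective (↑(stabSets τ j) : Set (Finset T))
        (f := fun S : Finset T => (Subtype.val '' (S : Set T) : Set Z)) (by
          intro S S' h
          exact Finset.coe_injective (Set.image_injective.2 Subtype.val_injective h))]
    congr 1
    ext S
    simp only [Set.mem_setOf_eq, Set.mem_image, Finset.mem_coe, stabSets, Finset.mem_filter,
      Finset.mem_univ, true_and]
    constructor
    · rintro ⟨h1, h2, h3, h4⟩
      have hST : S ⊆ T := by
        intro x hx
        obtain ⟨m, m1, m2, m3⟩ := exists_period σ hσ S h2 h4 x hx
        exact ⟨h1 hx, m, m1, by omega, m3⟩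
      have himg : Subtype.val '' ((Finset.univ.filter fun x : T => (x : Z) ∈ S : Finset T) : Set T) = S := by
        ext x
        simp only [Set.mem_image, Finset.mem_coe, Finset.mem_filter, Finset.mem_univ, true_and]
        constructor
        · rintro ⟨y, hy, rfl⟩; exact hy
        · intro hx; exact ⟨⟨x, hST hx⟩, hx, rfl⟩
      refine ⟨Finset.univ.filter fun x : T => (x : Z) ∈ S, ⟨?_, ?_⟩, himg⟩
      · rw [← Set.ncard_coe_finset, ← Set.ncard_image_of_injective _ Subtype.val_injective, himg, h3]
      · intro y
        simp only [Finset.mem_filter, Finset.mem_univ, true_and, hτ]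
        constructor
        · intro h
          rw [← h4] at h
          obtain ⟨z, hz, hz'⟩ := h
          rwa [← hσ hz']
        · intro h
          rw [← h4]
          exact ⟨_, h, rfl⟩
    · rintro ⟨S', ⟨h1, h2⟩, rfl⟩
      refine ⟨?_, (Finset.finite_toSet _).image _, ?_, ?_⟩
      · rintro _ ⟨y, -, rfl⟩
        exact y.2.1
      · rw [Set.ncard_image_of_injective _ Subtype.val_injective, Set.ncard_coe_finset, h1]
      · ext x
        constructor
        · rintro ⟨_, ⟨y, hy, rfl⟩, rfl⟩
          exact ⟨τ y, (h2 y).2 hy, rfl⟩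
        · rintro ⟨y, hy, rfl⟩
          obtain ⟨z, rfl⟩ := τ.surjective y
          exact ⟨z, ⟨z, (h2 z).1 hy, rfl⟩, rfl⟩
  have hfix : ∀ m, 0 < m → m ≤ n →
      ((Finset.univ.filter fun y : T => τ^[m] y = y).card : ℚ) = (q^m-1)^2 := by
    intro m h1 h2
    rw [← (hN m h1).2, ← Set.ncard_coe_finset, ← Set.ncard_image_of_injective _ Subtype.val_injective]
    congr 2
    ext x
    simp only [Set.mem_image, Finset.mem_coe, Finset.mem_filter, Finset.mem_univ, true_and,
      Set.mem_setOf_eq]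
    constructor
    · rintro ⟨y, hy, rfl⟩
      exact ⟨y.2.1, by rw [← hτi, hy]⟩
    · rintro ⟨hx, hx'⟩
      exact ⟨⟨x, hx, m, h1, h2, hx'⟩, Subtype.ext ((hτi m _).trans hx'), rfl⟩
  have hcs : ∀ m, m ≤ n → (∑ x, PowerSeries.coeff m (eSer (Function.minimalPeriod τ x))) =
      PowerSeries.coeff m (cSer q) := by
    intro m hm
    rcases Nat.eq_zero_or_pos m with rfl | h0
    · simp [eSer, cSer]
    · have hfm := hfix m h0 hm
      have hce := coeff_eSum τ m h0
      have hf2 := fun h1 => hfix (m/2) h1 (by omega)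
      rw [hce]
      trans ((q^m-1)^2 - 2 * (if Even m then (q^(m/2)-1)^2 else 0))
      · congr 1
        · convert hfm using 3; ext y; simp only [Finset.mem_filter]
        · by_cases he : Even m
          · have : 2 ≤ m := by obtain ⟨l, rfl⟩ := he; omega
            rw [if_pos he, if_pos he]
            congr 1
            convert hf2 (by omega) using 3; ext y; simp only [Finset.mem_filter]
          · rw [if_neg he, if_neg he]
      simp only [cSer, PowerSeries.coeff_mk, h0.ne', if_false]
  have hrec := rec_perm τ n
  have hg := congrArg (PowerSeries.coeff n) (gSer_deriv q w hw)
  rw [PowerSeries.coeff_mul n (cSer q)] at hg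
  obtain ⟨n', rfl⟩ : ∃ n', n = n' + 1 := ⟨n - 1, by omega⟩
  rw [PowerSeries.coeff_succ_X_mul, PowerSeries.coeff_derivative] at hg
  have hsum : ∑ p ∈ Finset.HasAntidiagonal.antidiagonal (n'+1),
      (∑ x, PowerSeries.coeff p.1 (eSer (Function.minimalPeriod τ x))) * ((stabSets τ p.2).card : ℚ) =
      ∑ p ∈ Finset.HasAntidiagonal.antidiagonal (n'+1),
        PowerSeries.coeff p.1 (cSer q) * PowerSeries.coeff p.2 (gSer q w) := by
    apply Finset.sum_congr rfl
    rintro ⟨i, j⟩ hp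
    rw [Finset.HasAntidiagonal.mem_antidiagonal] at hp
    simp only at hp ⊢
    rw [hcs i (by omega)]
    rcases Nat.eq_zero_or_pos i with rfl | h0
    · simp [cSer]
    · rw [← hcount j (by omega), ih j (by omega)]
  rw [hsum, ← hg, ← hcount _ le_rfl] at hrec
  have : ((n' + 1 : ℕ) : ℚ) ≠ 0 := by positivity
  apply mul_left_cancel₀ this
  rw [hrec]
  push_cast
  ring

lemma frob_fix_card (k : Type*) [Field k] [Fintype k] (m : ℕ) (hm : 0 < m) :
    {z : AlgebraicClosure k | z ^ (Fintype.card k ^ m) = z}.Finite ∧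
    {z : AlgebraicClosure k | z ^ (Fintype.card k ^ m) = z}.ncard = Fintype.card k ^ m := by
  classical
  obtain ⟨p, hp⟩ := CharP.exists k
  have hcard : 1 < Fintype.card k := Fintype.one_lt_card
  have hlt : 1 < Fintype.card k ^ m := Nat.one_lt_pow hm.ne' hcard
  have hsep : (Polynomial.X ^ (Fintype.card k ^ m) - Polynomial.X : Polynomial k).Separable :=
    galois_poly_separable p _ (by
      apply dvd_pow _ hm.ne'
      rw [← CharP.cast_eq_zero_iff k p]
      simp)
  have hdeg := FiniteField.X_pow_card_sub_X_natDegree_eq k hlt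
  have hne := FiniteField.X_pow_card_sub_X_ne_zero k hlt
  have h := Polynomial.card_rootSet_eq_natDegree (K := AlgebraicClosure k) hsep
    (IsAlgClosed.splits _)
  rw [hdeg] at h
  have hset : {z : AlgebraicClosure k | z ^ (Fintype.card k ^ m) = z} =
      (Polynomial.X ^ (Fintype.card k ^ m) - Polynomial.X : Polynomial k).rootSet
        (AlgebraicClosure k) := by
    ext z
    rw [Polynomial.mem_rootSet_of_ne hne]
    simp [sub_eq_zero]
  rw [hset]
  refine ⟨Set.toFinite _, ?_⟩
  rw [← Nat.card_coe_set_eq, Nat.card_eq_fintype_card]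
  exact h

lemma afFrob_iter (k : Type*) [Field k] [Fintype k] (N m : ℕ) (v : Fin N → AlgebraicClosure k)
    (i : Fin N) : ((afFrob k N)^[m] v) i = v i ^ (Fintype.card k ^ m) := by
  induction m with
  | zero => simp
  | succ m ih =>
    rw [Function.iterate_succ_apply', pow_succ, pow_mul, ← ih]
    rfl

lemma frob_add (k : Type*) [Field k] [Fintype k] (m : ℕ) (x y : AlgebraicClosure k) :
    (x + y) ^ (Fintype.card k ^ m) = x ^ (Fintype.card k ^ m) + y ^ (Fintype.card k ^ m) := by
  obtain ⟨p, hp⟩ := CharP.exists k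
  obtain ⟨e, hpp, he⟩ := FiniteField.card k p
  haveI : Fact p.Prime := ⟨hpp⟩
  haveI : CharP (AlgebraicClosure k) p := charP_of_injective_algebraMap (algebraMap k _).injective p
  rw [he, ← pow_mul]
  exact add_pow_char_pow _ _ _ _

lemma frob_sub (k : Type*) [Field k] [Fintype k] (m : ℕ) (x y : AlgebraicClosure k) :
    (x - y) ^ (Fintype.card k ^ m) = x ^ (Fintype.card k ^ m) - y ^ (Fintype.card k ^ m) := by
  have := frob_add k m (x - y) y
  rw [sub_add_cancel] at this
  rw [this]; ring

lemma frob_alg (k : Type*) [Field k] [Fintype k] (m : ℕ) (a : k) :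
    (algebraMap k (AlgebraicClosure k) a) ^ (Fintype.card k ^ m) = algebraMap k _ a := by
  rw [← map_pow, FiniteField.pow_card_pow]

lemma frob_form (k : Type*) [Field k] [Fintype k] (m : ℕ) (a b c : k) (x y : AlgebraicClosure k) :
    (algebraMap k (AlgebraicClosure k) a * x + algebraMap k (AlgebraicClosure k) b * y -
      algebraMap k (AlgebraicClosure k) c) ^ (Fintype.card k ^ m) =
    algebraMap k (AlgebraicClosure k) a * x ^ (Fintype.card k ^ m) +
      algebraMap k (AlgebraicClosure k) b * y ^ (Fintype.card k ^ m) -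
      algebraMap k (AlgebraicClosure k) c := by
  rw [frob_sub, frob_add, mul_pow, mul_pow, frob_alg, frob_alg, frob_alg]

lemma fix_count (k : Type*) [Field k] [Fintype k]
    (a b c a' b' c' : k) (hdet : a * b' - a' * b ≠ 0) (A : Set (Fin 2 → AlgebraicClosure k))
    (hA : A = {v | algebraMap k (AlgebraicClosure k) a * v 0 +
        algebraMap k (AlgebraicClosure k) b * v 1 - algebraMap k (AlgebraicClosure k) c ≠ 0 ∧
      algebraMap k (AlgebraicClosure k) a' * v 0 +
        algebraMap k (AlgebraicClosure k) b' * v 1 - algebraMap k (AlgebraicClosure k) c' ≠ 0})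
    (m : ℕ) (hm : 0 < m) :
    {v | v ∈ A ∧ (afFrob k 2)^[m] v = v}.Finite ∧
    ({v | v ∈ A ∧ (afFrob k 2)^[m] v = v}.ncard : ℚ) = ((Fintype.card k : ℚ) ^ m - 1) ^ 2 := by
  obtain ⟨hF, hFc⟩ := frob_fix_card k m hm
  set F := {z : AlgebraicClosure k | z ^ (Fintype.card k ^ m) = z} with hFdef
  have hQ : Fintype.card k ^ m ≠ 0 := by
    have : 0 < Fintype.card k := Fintype.card_pos
    positivity
  have hdet' : algebraMap k (AlgebraicClosure k) a * algebraMap k (AlgebraicClosure k) b' -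
      algebraMap k (AlgebraicClosure k) a' * algebraMap k (AlgebraicClosure k) b ≠ 0 := by
    rw [← map_mul, ← map_mul, ← map_sub]
    exact (map_ne_zero _).2 hdet
  have hform := frob_form k m a b c
  have hform' := frob_form k m a' b' c'
  generalize algebraMap k (AlgebraicClosure k) a = α at *
  generalize algebraMap k (AlgebraicClosure k) b = β at *
  generalize algebraMap k (AlgebraicClosure k) c = γ at *
  generalize algebraMap k (AlgebraicClosure k) a' = α' at *
  generalize algebraMap k (AlgebraicClosure k) b' = β' at *
  generalize algebraMap k (AlgebraicClosure k) c' = γ' at *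
  let φ : (Fin 2 → AlgebraicClosure k) → AlgebraicClosure k × AlgebraicClosure k :=
    fun v => (α * v 0 + β * v 1 - γ, α' * v 0 + β' * v 1 - γ')
  have hinj : ∀ x y x' y', α * x + β * y - γ = α * x' + β * y' - γ →
      α' * x + β' * y - γ' = α' * x' + β' * y' - γ' → x = x' ∧ y = y' := by
    intro x y x' y' h1 h2
    constructor
    · apply mul_left_cancel₀ hdet'
      linear_combination β' * h1 - β * h2
    · apply mul_left_cancel₀ hdet'
      linear_combination α * h2 - α' * h1
  have hφi : Function.Injective φ := by
    intro v v' h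
    have h1 := congrArg Prod.fst h
    have h2 := congrArg Prod.snd h
    obtain ⟨e1, e2⟩ := hinj _ _ _ _ h1 h2
    ext i
    fin_cases i
    · exact e1
    · exact e2
  have himg : φ '' {v | v ∈ A ∧ (afFrob k 2)^[m] v = v} = (F \ {0}) ×ˢ (F \ {0}) := by
    ext ⟨x, y⟩
    simp only [Set.mem_image, Set.mem_prod, Set.mem_diff, Set.mem_singleton_iff, hFdef,
      Set.mem_setOf_eq, hA]
    constructor
    · rintro ⟨v, ⟨⟨h1, h2⟩, h3⟩, h4⟩
      have f0 := congrFun h3 0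
      have f1 := congrFun h3 1
      rw [afFrob_iter] at f0 f1
      have g1 : α * v 0 + β * v 1 - γ = x := congrArg Prod.fst h4
      have g2 : α' * v 0 + β' * v 1 - γ' = y := congrArg Prod.snd h4
      rw [← g1, ← g2, hform, hform', f0, f1]
      exact ⟨⟨rfl, h1⟩, rfl, h2⟩
    · rintro ⟨⟨h1, h2⟩, h3, h4⟩
      let v : Fin 2 → AlgebraicClosure k :=
        ![(β' * (x + γ) - β * (y + γ')) / (α * β' - α' * β),
          (α * (y + γ') - α' * (x + γ)) / (α * β' - α' * β)]
      have g1 : α * v 0 + β * v 1 - γ = x := by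
        simp only [v, Matrix.cons_val_zero, Matrix.cons_val_one]
        rw [mul_div_assoc', mul_div_assoc', ← add_div, sub_eq_iff_eq_add, div_eq_iff hdet']
        ring
      have g2 : α' * v 0 + β' * v 1 - γ' = y := by
        simp only [v, Matrix.cons_val_zero, Matrix.cons_val_one]
        rw [mul_div_assoc', mul_div_assoc', ← add_div, sub_eq_iff_eq_add, div_eq_iff hdet']
        ring
      refine ⟨v, ⟨⟨by rw [g1]; exact h2, by rw [g2]; exact h4⟩, ?_⟩, Prod.ext g1 g2⟩
      have k1 := hform (v 0) (v 1)
      have k2 := hform' (v 0) (v 1)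
      rw [g1, h1, ← g1] at k1
      rw [g2, h3, ← g2] at k2
      obtain ⟨e1, e2⟩ := hinj _ _ _ _ k1 k2
      ext i
      rw [afFrob_iter]
      fin_cases i
      · exact e1.symm
      · exact e2.symm
  have h0 : (0 : AlgebraicClosure k) ∈ F := by simp [hFdef, hQ]
  constructor
  · apply Set.Finite.of_finite_image _ hφi.injOn
    rw [himg]
    exact (hF.diff).prod hF.diff
  · rw [← Set.ncard_image_of_injective _ hφi, himg, Set.ncard_prod,
      Set.ncard_diff_singleton_of_mem h0, hFc, Nat.cast_mul, Nat.cast_sub (by omega)]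
    push_cast
    ring

/-- Let `L, L' ⊆ k̄²` be two non-parallel lines defined over `𝔽_q`
(meeting in exactly one point).  Then the number `a(n)` of `n`-element
subsets `S ⊆ k̄² \ (L ∪ L')` with `σ(S) = S` is given, for `n` even
(`n > 0`) and `n` odd (`n > 1`) respectively, by the two displayed
formulas. -/
theorem stmt4 (k : Type*) [Field k] [Fintype k] (q n : ℕ)
    (hq : Fintype.card k = q)
    (a b c a' b' c' : k) (hab : ¬(a = 0 ∧ b = 0)) (hab' : ¬(a' = 0 ∧ b' = 0))
    (L L' : Set (Fin 2 → AlgebraicClosure k))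
    (hL : L = {v : Fin 2 → AlgebraicClosure k |
      algebraMap k (AlgebraicClosure k) a * v 0 +
        algebraMap k (AlgebraicClosure k) b * v 1 =
          algebraMap k (AlgebraicClosure k) c})
    (hL' : L' = {v : Fin 2 → AlgebraicClosure k |
      algebraMap k (AlgebraicClosure k) a' * v 0 +
        algebraMap k (AlgebraicClosure k) b' * v 1 =
          algebraMap k (AlgebraicClosure k) c'})
    (hmeet : ∃! P : Fin 2 → AlgebraicClosure k, P ∈ L ∧ P ∈ L') :
    (Even n → 0 < n →
      (nSetCount (afFrob k 2) (L ∪ L')ᶜ n : ℚ) =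
        (((q : ℚ) ^ 4 - 1) / ((q : ℚ) ^ 2 + q + 1) ^ 2) *
          ((q : ℚ) ^ (2 * n) -
            (q : ℚ) ^ (n / 2) *
              (((n : ℚ) / 2) * (((q : ℚ) ^ 3 - 1) * ((q : ℚ) - 1) / ((q : ℚ) ^ 4 - 1)) + 1))) ∧
    (Odd n → 1 < n →
      (nSetCount (afFrob k 2) (L ∪ L')ᶜ n : ℚ) =
        (((q : ℚ) ^ 4 - 1) / ((q : ℚ) ^ 2 + q + 1) ^ 2) *
          ((q : ℚ) ^ (2 * n) +
            (q : ℚ) ^ ((n - 1) / 2) *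
              ((((n : ℚ) - 1) / 2) * (((q : ℚ) ^ 3 - 1) / ((q : ℚ) ^ 2 + 1)) -
                ((q : ℚ) - 1) * (2 * (q : ℚ) ^ 2 + q + 1) / ((q : ℚ) ^ 4 - 1)))) := by
  have hdet : a * b' - a' * b ≠ 0 := by
    intro h
    obtain ⟨P, ⟨hP, hP'⟩, huniq⟩ := hmeet
    rw [hL] at hP
    rw [hL'] at hP'
    simp only [Set.mem_setOf_eq] at hP hP'
    have hz : algebraMap k (AlgebraicClosure k) a * algebraMap k (AlgebraicClosure k) b' -
        algebraMap k (AlgebraicClosure k) a' * algebraMap k (AlgebraicClosure k) b = 0 := by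
      rw [← map_mul, ← map_mul, ← map_sub, h, map_zero]
    have := huniq ![P 0 + algebraMap k (AlgebraicClosure k) b,
      P 1 - algebraMap k (AlgebraicClosure k) a] (by
        rw [hL, hL']
        simp only [Set.mem_setOf_eq, Matrix.cons_val_zero, Matrix.cons_val_one]
        constructor
        · linear_combination hP
        · linear_combination hP' - hz)
    have e0 := congrFun this 0
    have e1 := congrFun this 1
    simp at e0 e1
    exact hab ⟨e1, e0⟩
  have hA : (L ∪ L')ᶜ = {v | algebraMap k (AlgebraicClosure k) a * v 0 +
        algebraMap k (AlgebraicClosure k) b * v 1 - algebraMap k (AlgebraicClosure k) c ≠ 0 ∧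
      algebraMap k (AlgebraicClosure k) a' * v 0 +
        algebraMap k (AlgebraicClosure k) b' * v 1 - algebraMap k (AlgebraicClosure k) c' ≠ 0} := by
    ext v
    rw [hL, hL']
    simp only [Set.mem_compl_iff, Set.mem_union, Set.mem_setOf_eq, not_or, ne_eq, sub_eq_zero]
  have hinj : Function.Injective (afFrob k 2) := by
    intro v v' h
    ext i
    have h1 : v i ^ Fintype.card k = v' i ^ Fintype.card k := congrFun h i
    have h2 := frob_sub k 1 (v i) (v' i)
    rw [pow_one, h1, sub_self] at h2
    exact sub_eq_zero.1 (pow_eq_zero_iff Fintype.card_ne_zero |>.1 h2)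
  have hstab : ∀ v ∈ (L ∪ L')ᶜ, afFrob k 2 v ∈ (L ∪ L')ᶜ := by
    rw [hA]
    rintro v ⟨h1, h2⟩
    have k1 := frob_form k 1 a b c (v 0) (v 1)
    have k2 := frob_form k 1 a' b' c' (v 0) (v 1)
    rw [pow_one] at k1 k2
    refine ⟨?_, ?_⟩
    · change algebraMap k (AlgebraicClosure k) a * v 0 ^ Fintype.card k +
        algebraMap k (AlgebraicClosure k) b * v 1 ^ Fintype.card k -
          algebraMap k (AlgebraicClosure k) c ≠ 0
      rw [← k1]; exact pow_ne_zero _ h1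
    · change algebraMap k (AlgebraicClosure k) a' * v 0 ^ Fintype.card k +
        algebraMap k (AlgebraicClosure k) b' * v 1 ^ Fintype.card k -
          algebraMap k (AlgebraicClosure k) c' ≠ 0
      rw [← k2]; exact pow_ne_zero _ h2
  have hq1 : (1 : ℚ) < q := by
    rw [← hq]; exact_mod_cast Fintype.one_lt_card
  have hs : ((q : ℚ)^2 + q + 1) ≠ 0 := by positivity
  have h41 : ((q : ℚ)^4 - 1) ≠ 0 := by
    have : (1 : ℚ) < (q : ℚ)^4 := one_lt_pow₀ hq1 (by norm_num)
    linarith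
  have h21 : ((q : ℚ)^2 + 1) ≠ 0 := by positivity
  have main := main_abs (afFrob k 2) hinj (L ∪ L')ᶜ hstab (q : ℚ) (((q : ℚ)^2 + q + 1)⁻¹)
    (inv_mul_cancel₀ hs) (fun m hm => by
      have := fix_count k a b c a' b' c' hdet _ hA m hm
      rwa [hq] at this) n
  rw [main]
  constructor
  · rintro he hn
    obtain ⟨j, rfl⟩ := he
    obtain ⟨i, rfl⟩ : ∃ i, j = i + 1 := ⟨j - 1, by omega⟩
    rw [show i + 1 + (i + 1) = 2 * i + 1 + 1 by ring]
    have o1 : ¬ Even (2 * i + 1) := by simp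
    have o2 : Even (2 * i + 1 + 1) := by rw [Nat.even_add_one]; exact o1
    have d1 : (2 * i + 1 + 1) / 2 = i + 1 := by omega
    simp only [gSer, map_add, map_sub, add_mul, sub_mul, mul_assoc, PowerSeries.coeff_C_mul,
      PowerSeries.coeff_succ_X_mul, PowerSeries.coeff_mk, PowerSeries.coeff_one, if_neg o1, if_pos o2, d1]
    rw [if_neg (by omega)]
    rw [← pow_mul]
    push_cast
    field_simp
    ring
  · rintro he hn
    obtain ⟨j, rfl⟩ := he
    have o1 : Even (2 * j) := by simp
    have o2 : ¬ Even (2 * j + 1) := by simp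
    have d1 : (2 * j) / 2 = j := by omega
    have d2 : (2 * j + 1 - 1) / 2 = j := by omega
    simp only [gSer, map_add, map_sub, add_mul, sub_mul, mul_assoc, PowerSeries.coeff_C_mul,
      PowerSeries.coeff_succ_X_mul, PowerSeries.coeff_mk, PowerSeries.coeff_one, if_pos o1, if_neg o2, d1, d2]
    rw [if_neg (by omega)]
    rw [← pow_mul]
    push_cast
    field_simp
    ring
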